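/- Let a, b, a', b', c be positive reals and wu, wv, wp, wq real numbers (thought of as conformal factors at the four vertices u, v, p, q of a quadrilateral with diagonal uv of length c, where triangle (u,v,p) has sides a = l(u,p), b = l(v,p), c = l(u,v) and triangle (u,v,q) has sides a' = l(u,q), b' = l(v,q), c = l(u,v)). Define scaled lengths l̃(x,y) = exp(wx+wy)·l(x,y) and assume both scaled triangles satisfy the strict triangle inequalities. Let α ∈ (0,π) be the angle at p in the scaled triangle (u,v,p) and α' ∈ (0,π) the angle at q in the scaled triangle (u,v,q), defined by the law of cosines. Set x_s = exp(−2·w_s) for s ∈ {u,v,p,q}. Then the Delaunay condition α + α' ≤ π holds if and only if (a/b + a'/b')·x_v + (b/a + b'/a')·x_u − (c²/(a·b))·x_p − (c²/(a'·b'))·x_q ≥ 0; in particular, in the variables x the Delaunay condition for the diagonal is a linear inequality. -/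

import Mathlib

/-- Two arccosines sum to at most `π` exactly when their arguments have nonnegative sum. -/
theorem arccos_add_arccos_le_pi_iff {x y : ℝ} (hx : x ∈ Set.Icc (-1 : ℝ) 1)
    (hy : y ∈ Set.Icc (-1 : ℝ) 1) :
    Real.arccos x + Real.arccos y ≤ Real.pi ↔ 0 ≤ x + y := by
  have hy' : -y ∈ Set.Icc (-1 : ℝ) 1 := ⟨by linarith [hy.2], by linarith [hy.1]⟩
  rw [← le_sub_iff_add_le, ← Real.arccos_neg, Real.strictAntiOn_arccos.le_iff_ge hx hy',
    neg_le_iff_add_nonneg]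

/-- The law-of-cosines quotient of a Euclidean triangle lies in `[-1, 1]`. -/
theorem cosine_quotient_mem_Icc {A B C : ℝ} (hA : 0 < A) (hB : 0 < B)
    (h : A < B + C ∧ B < A + C ∧ C < A + B) :
    (A ^ 2 + B ^ 2 - C ^ 2) / (2 * A * B) ∈ Set.Icc (-1 : ℝ) 1 := by
  obtain ⟨h₁, h₂, h₃⟩ := h
  have hAB : 0 < 2 * A * B := by positivity
  constructor
  · rw [le_div_iff₀ hAB]
    nlinarith
  · rw [div_le_iff₀ hAB]
    nlinarith [mul_pos (sub_pos.2 h₁) (sub_pos.2 h₂)]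

/-- The law-of-cosines quotient of a vertex-scaled triangle, in terms of the unscaled lengths. -/
theorem cosine_quotient_vertex_scaling {a b : ℝ} (ha : 0 < a) (hb : 0 < b) (c wu wv wp : ℝ) :
    ((Real.exp (wu + wp) * a) ^ 2 + (Real.exp (wv + wp) * b) ^ 2 - (Real.exp (wu + wv) * c) ^ 2)
        / (2 * (Real.exp (wu + wp) * a) * (Real.exp (wv + wp) * b))
      = Real.exp (wu + wv) / 2 * (a / b * Real.exp (-2 * wv) + b / a * Real.exp (-2 * wu)
          - c ^ 2 / (a * b) * Real.exp (-2 * wp)) := by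
  have hexp (w : ℝ) : Real.exp (-2 * w) = (Real.exp w ^ 2)⁻¹ := by
    rw [← Real.exp_nat_mul, ← Real.exp_neg]
    push_cast
    ring_nf
  simp only [hexp, Real.exp_add]
  field_simp

theorem delaunay_condition_linear_in_x
    (a b a' b' c : ℝ)
    (ha : 0 < a) (hb : 0 < b) (ha' : 0 < a') (hb' : 0 < b') (hc : 0 < c)
    (wu wv wp wq : ℝ)
    (A B C A' B' : ℝ)
    (hA : A = Real.exp (wu + wp) * a) (hB : B = Real.exp (wv + wp) * b)
    (hC : C = Real.exp (wu + wv) * c)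
    (hA' : A' = Real.exp (wu + wq) * a') (hB' : B' = Real.exp (wv + wq) * b')
    (htri : A < B + C ∧ B < A + C ∧ C < A + B)
    (htri' : A' < B' + C ∧ B' < A' + C ∧ C < A' + B') :
    Real.arccos ((A ^ 2 + B ^ 2 - C ^ 2) / (2 * A * B))
        + Real.arccos ((A' ^ 2 + B' ^ 2 - C ^ 2) / (2 * A' * B')) ≤ Real.pi
      ↔ 0 ≤ (a / b + a' / b') * Real.exp (-2 * wv) + (b / a + b' / a') * Real.exp (-2 * wu)
          - c ^ 2 / (a * b) * Real.exp (-2 * wp) - c ^ 2 / (a' * b') * Real.exp (-2 * wq) := by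
  have hmem := cosine_quotient_mem_Icc (hA ▸ by positivity) (hB ▸ by positivity) htri
  have hmem' := cosine_quotient_mem_Icc (hA' ▸ by positivity) (hB' ▸ by positivity) htri'
  rw [arccos_add_arccos_le_pi_iff hmem hmem', hA, hB, hC, hA', hB',
    cosine_quotient_vertex_scaling ha hb, cosine_quotient_vertex_scaling ha' hb', ← mul_add,
    mul_nonneg_iff_of_pos_left (by positivity)]
  ring_nf
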